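/- Let m, n ≥ 2 with (m−1)·(n−1) > 1, and consider the Cayley graph 𝒢 of the free product C_m * C_n of cyclic groups of orders m and n with respect to the standard generators (one generator for each cyclic factor). Let h(𝒢) = inf over nonempty finite vertex sets K of |∂K|/|K| be the Cheeger constant, where ∂K is the set of edges with exactly one endpoint in K. Then the critical probability p_c of 𝒢 satisfies 1/3 < p_c < 1/(h(𝒢) + 1). -/

import Mathlib

open MeasureTheory ENNReal

namespace Perc

/-- Percolation configurations on the edge set `E`: each edge is `true` (open) or
`false` (closed). -/
abbrev Config (E : Type*) := E → Bool

/-- `μ` is the Bernoulli product measure `P_p` with parameter `p` on `{0,1}^E`: the measure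
of every finite cylinder event is the corresponding product.  (This determines `μ` uniquely
on the product σ-algebra, since cylinders form a π-system generating it.) -/
def IsBernoulli {E : Type*} (p : ℝ) (μ : Measure (Config E)) : Prop :=
  ∀ (F : Finset E) (σ : E → Bool),
    μ {ω | ∀ e ∈ F, ω e = σ e} =
      ∏ e ∈ F, ENNReal.ofReal (if σ e then p else 1 - p)

variable {G ι : Type*} [Group G]

/-- In the Cayley graph of `G` with edge set `G × ι`, where the edge `(a, i)` joins `a` and
`a * f i` (the function `f : ι → G` lists the generators, with multiplicity), this says that
vertices `a` and `b` are joined by some open edge of the configuration `ω`. -/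
def Step (f : ι → G) (ω : Config (G × ι)) (a b : G) : Prop :=
  ∃ i : ι, (ω (a, i) = true ∧ b = a * f i) ∨ (ω (b, i) = true ∧ a = b * f i)

/-- `x` and `y` are connected by a path of open edges (`x ↔ y`). -/
def Conn (f : ι → G) (ω : Config (G × ι)) (x y : G) : Prop :=
  Relation.ReflTransGen (Step f ω) x y

/-- The open cluster `C` of the identity. -/
def cluster (f : ι → G) (ω : Config (G × ι)) : Set G :=
  {x | Conn f ω 1 x}

/-- The percolation function `θ`: the probability that the cluster of the identity is
infinite. -/
noncomputable def theta (f : ι → G) (μ : Measure (Config (G × ι))) : ℝ :=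
  (μ {ω | (cluster f ω).Infinite}).toReal

/-- The expected cluster size `χ = E(|C|) ∈ [0,∞]` (where `|C| ∈ ℕ∞` is coerced
to `ℝ≥0∞`). -/
noncomputable def chi (f : ι → G) (μ : Measure (Config (G × ι))) : ℝ≥0∞ :=
  ∫⁻ ω, ((cluster f ω).encard : ℝ≥0∞) ∂μ

/-- The critical probability `p_c = inf {p ∈ [0,1] | θ(p) > 0}`, with the convention
`p_c = 1` if `θ` vanishes on `[0,1]`; here `μ p` is the percolation measure at
parameter `p`. -/
noncomputable def pc (f : ι → G) (μ : ℝ → Measure (Config (G × ι))) : ℝ :=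
  sInf ({p | p ∈ Set.Icc (0 : ℝ) 1 ∧ 0 < theta f (μ p)} ∪ {1})

/-- The word metric on `G` with respect to the generators `f i`: the length of a shortest
word in the generators and their inverses taking `x` to `y`.  (When the generators generate
`G`, this is the graph distance in the Cayley graph.) -/
noncomputable def wdist (f : ι → G) (x y : G) : ℕ :=
  sInf {n : ℕ | ∃ l : List G, l.length = n ∧
    (∀ g ∈ l, (∃ i, f i = g) ∨ (∃ i, (f i)⁻¹ = g)) ∧ x * l.prod = y}

/-- Schonmann's critical point
`p_exp = sup {p ∈ [0,1] | ∃ c > 0, γ > 0, ∀ x y, P_p(x ↔ y) ≤ c·exp(-γ·dist(x,y))}`. -/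
noncomputable def pexp (f : ι → G) (μ : ℝ → Measure (Config (G × ι))) : ℝ :=
  sSup {p | p ∈ Set.Icc (0 : ℝ) 1 ∧ ∃ c > 0, ∃ γ > 0, ∀ x y : G,
    (μ p {ω | Conn f ω x y}).toReal ≤ c * Real.exp (-γ * (wdist f x y : ℝ))}

/-- The walk-through function `g(p,t) = 1 - ∑_{n≥1} (1-t)^{n-1} P_p(|C| = n)` of a Cayley
graph; here `μ` is the percolation measure at parameter `p`. -/
noncomputable def wt (f : ι → G) (μ : Measure (Config (G × ι))) (t : ℝ) : ℝ :=
  1 - ∑' n : ℕ, (1 - t) ^ n * (μ {ω | (cluster f ω).encard = ((n + 1 : ℕ) : ℕ∞)}).toReal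

/-- The ball of radius `j`: all products of at most `j` elements of `S ∪ S⁻¹`. -/
def ball (S : Set G) (j : ℕ) : Set G :=
  {g | ∃ l : List G, l.length ≤ j ∧ (∀ x ∈ l, x ∈ S ∨ x⁻¹ ∈ S) ∧ l.prod = g}

/-- The Cheeger constant `h = inf_K |∂K| / |K|`, the infimum over nonempty finite vertex
sets `K` of the number of edges `(a, i)` (joining `a` and `a * f i`) with exactly one
endpoint in `K`, divided by `|K|`. -/
noncomputable def cheeger (f : ι → G) : ℝ :=
  ⨅ K : {K : Finset G // K.Nonempty},
    (Nat.card {e : G × ι // Xor' (e.1 ∈ K.1) (e.1 * f e.2 ∈ K.1)} : ℝ) / (K.1.card : ℝ)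

/-- The open cluster of the identity in the subgraph induced on the vertex set `V`: only
open edges with both endpoints in `V` may be used. -/
def clusterIn (f : ι → G) (V : Set G) (ω : Config (G × ι)) : Set G :=
  {x | Relation.ReflTransGen (fun a b => Step f ω a b ∧ a ∈ V ∧ b ∈ V) 1 x}

/-- The generators of `G` given by a generating set `S` (one edge orbit per element
of `S`). -/
def setGens (S : Set G) : S → G := Subtype.val

/-- The generators of the free product `G₁ * G₂` given by the disjoint union `S₁ ⊔ S₂` of
generating sets, embedded via the canonical monomorphisms. -/
def coprodGens {G₁ G₂ : Type*} [Group G₁] [Group G₂] (S₁ : Set G₁) (S₂ : Set G₂) :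
    S₁ ⊕ S₂ → Monoid.Coprod G₁ G₂ :=
  Sum.elim (fun s => Monoid.Coprod.inl (s : G₁)) (fun s => Monoid.Coprod.inr (s : G₂))

/-- The generators of the free product `G₁ * ⋯ * G_n` given by the disjoint union
`S₁ ⊔ ⋯ ⊔ S_n` of generating sets, embedded via the canonical monomorphisms. -/
def coprodIGens {n : ℕ} {G : Fin n → Type*} [∀ i, Group (G i)] (S : ∀ i, Set (G i)) :
    (Σ i, S i) → Monoid.CoprodI G :=
  fun x => Monoid.CoprodI.of (x.2 : G x.1)

/-- The image of a list of syllables in the free product `G₁ * G₂`. -/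
def sylProd {G₁ G₂ : Type*} [Group G₁] [Group G₂] (l : List (G₁ ⊕ G₂)) :
    Monoid.Coprod G₁ G₂ :=
  (l.map (Sum.elim (fun g => Monoid.Coprod.inl g) (fun h => Monoid.Coprod.inr h))).prod

/-- The set `P₁` of nontrivial elements of `G₁ * G₂` whose normal form begins with a
nontrivial syllable of `G₁`: elements represented by a nonempty alternating product of
nontrivial syllables, the first syllable lying in `G₁`.  (Such a representation is the
normal form, which is unique.) -/
def beginsLeft {G₁ G₂ : Type*} [Group G₁] [Group G₂] (x : Monoid.Coprod G₁ G₂) : Prop :=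
  ∃ l : List (G₁ ⊕ G₂), l ≠ [] ∧ (∀ a ∈ l, a ≠ Sum.inl 1 ∧ a ≠ Sum.inr 1) ∧
    l.Chain' (fun a b => a.isLeft ≠ b.isLeft) ∧
    (∃ g : G₁, l.head? = some (Sum.inl g)) ∧ sylProd l = x

/-- The set `P₂` of nontrivial elements of `G₁ * G₂` whose normal form begins with a
nontrivial syllable of `G₂`. -/
def beginsRight {G₁ G₂ : Type*} [Group G₁] [Group G₂] (x : Monoid.Coprod G₁ G₂) : Prop :=
  ∃ l : List (G₁ ⊕ G₂), l ≠ [] ∧ (∀ a ∈ l, a ≠ Sum.inl 1 ∧ a ≠ Sum.inr 1) ∧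
    l.Chain' (fun a b => a.isLeft ≠ b.isLeft) ∧
    (∃ h : G₂, l.head? = some (Sum.inr h)) ∧ sylProd l = x

end Perc

namespace Perc

section Bernoulli

variable {E : Type*} {p : ℝ} {μ : Measure (Config E)}

/-- The event that the edge `e` is open. -/
def openAt (e : E) : Set (Config E) := {ω | ω e = true}

lemma IsBernoulli.isProbabilityMeasure (hμ : IsBernoulli p μ) : IsProbabilityMeasure μ := by
  refine ⟨?_⟩
  have := hμ ∅ (fun _ => true)
  simpa using this

lemma IsBernoulli.measure_forall_open (hμ : IsBernoulli p μ) (F : Finset E) :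
    μ {ω | ∀ e ∈ F, ω e = true} = ENNReal.ofReal p ^ F.card := by
  have := hμ F (fun _ => true)
  simpa using this

end Bernoulli

section Words

variable {G ι : Type*} [Group G]

/-- The group element by which a letter (a generator with an orientation) moves a vertex. -/
def letterVal (f : ι → G) (x : ι × Bool) : G := if x.2 then f x.1 else (f x.1)⁻¹

/-- The letter traversing the same edges in the opposite direction. -/
def letterInv (x : ι × Bool) : ι × Bool := (x.1, !x.2)

/-- The edge traversed from the vertex `v` by a letter. -/
def letterEdge (f : ι → G) (v : G) (x : ι × Bool) : G × ι :=
  (if x.2 then v else v * (f x.1)⁻¹, x.1)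

/-- The group element represented by a word. -/
def wordVal (f : ι → G) (l : List (ι × Bool)) : G := (l.map (letterVal f)).prod

/-- The edges traversed by a word read from the vertex `v`. -/
def wordEdges (f : ι → G) : G → List (ι × Bool) → List (G × ι)
  | _, [] => []
  | v, x :: l => letterEdge f v x :: wordEdges f (v * letterVal f x) l

/-- A word is self-avoiding if none of its nonempty factors represents the identity. -/
def SelfAvoiding (f : ι → G) (l : List (ι × Bool)) : Prop :=
  ∀ u, u <:+: l → u ≠ [] → wordVal f u ≠ 1

variable (f : ι → G)

@[simp] lemma wordVal_nil : wordVal f [] = 1 := by simp [wordVal]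

@[simp] lemma wordVal_cons (x : ι × Bool) (l : List (ι × Bool)) :
    wordVal f (x :: l) = letterVal f x * wordVal f l := by simp [wordVal]

@[simp] lemma wordVal_append (l l' : List (ι × Bool)) :
    wordVal f (l ++ l') = wordVal f l * wordVal f l' := by simp [wordVal]

@[simp] lemma letterVal_letterInv (x : ι × Bool) :
    letterVal f (letterInv x) = (letterVal f x)⁻¹ := by
  rcases x with ⟨i, _ | _⟩ <;> simp [letterVal, letterInv]

lemma wordVal_replicate (k : ℕ) (x : ι × Bool) :
    wordVal f (List.replicate k x) = letterVal f x ^ k := by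
  simp [wordVal]

lemma letterVal_pow {L : ℕ} (hf : ∀ i, f i ^ L = 1) (x : ι × Bool) : letterVal f x ^ L = 1 := by
  unfold letterVal
  split_ifs <;> simp [hf]

lemma wordEdges_append (v : G) (l l' : List (ι × Bool)) :
    wordEdges f v (l ++ l') = wordEdges f v l ++ wordEdges f (v * wordVal f l) l' := by
  induction l generalizing v with
  | nil => simp [wordEdges]
  | cons x l ih => simp [wordEdges, ih, mul_assoc]

@[simp] lemma length_wordEdges (v : G) (l : List (ι × Bool)) :
    (wordEdges f v l).length = l.length := by
  induction l generalizing v with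
  | nil => rfl
  | cons x l ih => simp [wordEdges, ih]

lemma mem_wordEdges {v : G} {l : List (ι × Bool)} {e : G × ι} (h : e ∈ wordEdges f v l) :
    ∃ a y b, l = a ++ y :: b ∧ e = letterEdge f (v * wordVal f a) y := by
  induction l generalizing v with
  | nil => simp [wordEdges] at h
  | cons x l ih =>
    rcases List.mem_cons.1 h with rfl | h
    · exact ⟨[], x, l, rfl, by simp⟩
    · obtain ⟨a, y, b, rfl, rfl⟩ := ih h
      exact ⟨x :: a, y, b, rfl, by simp [mul_assoc]⟩

variable {f}

lemma SelfAvoiding.of_infix {l l' : List (ι × Bool)} (h : SelfAvoiding f l) (hl : l' <:+: l) :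
    SelfAvoiding f l' :=
  fun u hu => h u (hu.trans hl)

lemma SelfAvoiding.nodup_wordEdges {l : List (ι × Bool)} (h : SelfAvoiding f l) (v : G) :
    (wordEdges f v l).Nodup := by
  induction l generalizing v with
  | nil => simp [wordEdges]
  | cons x l ih =>
    refine List.nodup_cons.2 ⟨fun hx => ?_, ih (h.of_infix (List.suffix_cons x l).isInfix) _⟩
    obtain ⟨a, y, b, rfl, he⟩ := mem_wordEdges f hx
    have h1 : wordVal f (x :: a) ≠ 1 :=
      h _ ⟨[], y :: b, by simp⟩ (by simp)
    have h2 : wordVal f (x :: a ++ [y]) ≠ 1 :=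
      h _ ⟨[], b, by simp⟩ (by simp)
    simp only [letterEdge, Prod.mk.injEq] at he
    obtain ⟨he1, he2⟩ := he
    rcases x with ⟨i, s⟩
    rcases y with ⟨j, t⟩
    obtain rfl : i = j := he2
    cases s <;> cases t <;>
      simp_all [letterVal, mul_assoc, mul_eq_one_iff_eq_inv]

lemma exists_word_of_conn {ω : Config (G × ι)} {v x : G} (h : Conn f ω v x) :
    ∃ l, (∀ e ∈ wordEdges f v l, ω e = true) ∧ v * wordVal f l = x := by
  induction h using Relation.ReflTransGen.head_induction_on with
  | refl => exact ⟨[], by simp [wordEdges]⟩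
  | head hs _ ih =>
    obtain ⟨l, hl, rfl⟩ := ih
    obtain ⟨i, ⟨ho, rfl⟩ | ⟨ho, rfl⟩⟩ := hs
    · refine ⟨(i, true) :: l, ?_, by simp [letterVal, mul_assoc]⟩
      simpa [wordEdges, letterEdge, letterVal, ho] using hl
    · refine ⟨(i, false) :: l, ?_, by simp [letterVal, mul_assoc]⟩
      simpa [wordEdges, letterEdge, letterVal, ho] using hl

lemma exists_selfAvoiding_of_conn {ω : Config (G × ι)} {v x : G} (h : Conn f ω v x) :
    ∃ l, (∀ e ∈ wordEdges f v l, ω e = true) ∧ v * wordVal f l = x ∧ SelfAvoiding f l := by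
  classical
  have hex : ∃ k, ∃ l : List (ι × Bool), l.length = k ∧
      (∀ e ∈ wordEdges f v l, ω e = true) ∧ v * wordVal f l = x := by
    obtain ⟨l, hl⟩ := exists_word_of_conn h
    exact ⟨_, l, rfl, hl⟩
  obtain ⟨l, hlen, ho, hx⟩ := Nat.find_spec hex
  refine ⟨l, ho, hx, ?_⟩
  rintro u ⟨a, b, rfl⟩ hu hu1
  have hlt : (a ++ b).length < Nat.find hex := by
    have := List.length_pos_iff.2 hu
    rw [← hlen]
    simp only [List.length_append]
    omega
  refine Nat.find_min hex hlt ⟨a ++ b, rfl, ?_, ?_⟩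
  · simp only [wordEdges_append, wordVal_append, hu1, mul_one, List.mem_append] at ho ⊢
    exact fun e he => ho e (he.imp_left Or.inl)
  · simpa [hu1, mul_assoc] using hx

lemma exists_selfAvoiding_of_infinite [Finite ι] {ω : Config (G × ι)}
    (h : (cluster f ω).Infinite) (k : ℕ) :
    ∃ l, l.length = k ∧ SelfAvoiding f l ∧ ∀ e ∈ wordEdges f 1 l, ω e = true := by
  by_contra hcon
  refine h (((List.finite_length_lt (ι × Bool) k).image (wordVal f)).subset fun x hx => ?_)
  obtain ⟨l, ho, hx, hl⟩ := exists_selfAvoiding_of_conn hx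
  refine ⟨l, lt_of_not_ge fun hk => hcon ⟨l.take k, by simpa using hk,
    hl.of_infix (List.take_prefix k l).isInfix, fun e he => ho e ?_⟩, by simpa using hx⟩
  rw [← List.take_append_drop k l, wordEdges_append]
  exact List.mem_append_left _ he

section Counting

variable [Fintype ι] [DecidableEq ι]

/-- The words of length `k` which, written after the letter `x`, do not backtrack. -/
def nonBacktracking : ℕ → ι × Bool → Finset (List (ι × Bool))
  | 0, _ => {[]}
  | k + 1, x => (Finset.univ.erase (letterInv x)).biUnion
      fun y => (nonBacktracking k y).image (y :: ·)

lemma card_nonBacktracking_le {b : ℕ} (hb : Fintype.card (ι × Bool) = b + 1) (k : ℕ)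
    (x : ι × Bool) : (nonBacktracking k x).card ≤ b ^ k := by
  induction k generalizing x with
  | zero => simp [nonBacktracking]
  | succ k ih =>
    refine (Finset.card_biUnion_le_card_mul _ _ (b ^ k)
      fun y _ => Finset.card_image_le.trans (ih y)).trans ?_
    rw [Finset.card_erase_of_mem (Finset.mem_univ _), Finset.card_univ, hb, pow_succ']
    simp

lemma replicate_mem_nonBacktracking (k : ℕ) (x : ι × Bool) :
    List.replicate k x ∈ nonBacktracking k x := by
  induction k with
  | zero => simp [nonBacktracking]
  | succ k ih =>
    refine Finset.mem_biUnion.2 ⟨x, ?_, Finset.mem_image.2 ⟨_, ih, rfl⟩⟩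
    rcases x with ⟨i, _ | _⟩ <;> simp [letterInv]

lemma SelfAvoiding.mem_nonBacktracking {x : ι × Bool} {u : List (ι × Bool)}
    (h : SelfAvoiding f (x :: u)) : u ∈ nonBacktracking u.length x := by
  induction u generalizing x with
  | nil => simp [nonBacktracking]
  | cons y u ih =>
    refine Finset.mem_biUnion.2 ⟨y, ?_, Finset.mem_image.2
      ⟨u, ih (h.of_infix (List.suffix_cons x _).isInfix), rfl⟩⟩
    simp only [Finset.mem_erase, Finset.mem_univ, and_true]
    rintro rfl
    exact h [x, letterInv x] ⟨[], u, by simp⟩ (by simp) (by simp)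

/-- Words made of `k` blocks of length `L`, written after the letter `x`, which do not
backtrack inside a block and in which no block repeats the letter preceding it `L` times. -/
def blockWords (L : ℕ) : ℕ → ι × Bool → Finset (List (ι × Bool))
  | 0, _ => {[]}
  | k + 1, x => ((nonBacktracking L x).erase (List.replicate L x)).biUnion
      fun u => (blockWords L k (u.getLastD x)).image (u ++ ·)

lemma card_blockWords_le {b : ℕ} (hb : Fintype.card (ι × Bool) = b + 1) (L k : ℕ)
    (x : ι × Bool) : (blockWords L k x).card ≤ (b ^ L - 1) ^ k := by
  induction k generalizing x with
  | zero => simp [blockWords]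
  | succ k ih =>
    refine (Finset.card_biUnion_le_card_mul _ _ ((b ^ L - 1) ^ k)
      fun y _ => Finset.card_image_le.trans (ih _)).trans ?_
    rw [Finset.card_erase_of_mem (replicate_mem_nonBacktracking L x), pow_succ']
    exact Nat.mul_le_mul_right _ (Nat.sub_le_sub_right (card_nonBacktracking_le hb L x) 1)

lemma SelfAvoiding.mem_blockWords {L : ℕ} (hL : 0 < L) (hf : ∀ i, f i ^ L = 1) {k : ℕ}
    {x : ι × Bool} {u : List (ι × Bool)} (hu : u.length = L * k)
    (h : SelfAvoiding f (x :: u)) : u ∈ blockWords L k x := by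
  induction k generalizing x u with
  | zero => simpa [blockWords] using hu
  | succ k ih =>
    obtain ⟨a, c, rfl, ha⟩ : ∃ a c, u = a ++ c ∧ a.length = L :=
      ⟨u.take L, u.drop L, by simp, by simp [hu, mul_add]⟩
    have hc : c.length = L * k := by
      simp only [List.length_append, mul_add] at hu
      omega
    have hxa : SelfAvoiding f (x :: a) := h.of_infix ⟨[], c, by simp⟩
    refine Finset.mem_biUnion.2 ⟨a, Finset.mem_erase.2 ⟨?_, ?_⟩,
      Finset.mem_image.2 ⟨c, ih hc (h.of_infix ?_), rfl⟩⟩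
    · rintro rfl
      refine hxa (List.replicate L x) (List.suffix_cons _ _).isInfix ?_ ?_
      · simpa using hL.ne'
      · rw [wordVal_replicate, letterVal_pow f hf]
    · have := hxa.mem_nonBacktracking
      rwa [ha] at this
    · obtain ⟨a', y, rfl⟩ := List.eq_nil_or_concat a |>.resolve_left
        (by rintro rfl; simp at ha; omega)
      exact ⟨x :: a', [], by simp⟩

end Counting

lemma measure_selfAvoiding_open_eq {p : ℝ} {μ : Measure (Config (G × ι))} (hμ : IsBernoulli p μ)
    {l : List (ι × Bool)} (hl : SelfAvoiding f l) :
    μ {ω | ∀ e ∈ wordEdges f 1 l, ω e = true} = ENNReal.ofReal p ^ l.length := by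
  classical
  have := hμ.measure_forall_open (wordEdges f 1 l).toFinset
  rw [List.toFinset_card_of_nodup (hl.nodup_wordEdges 1), length_wordEdges] at this
  simpa using this

lemma measure_infinite_le [Fintype ι] {b L : ℕ}
    (hb : Fintype.card (ι × Bool) = b + 1) (hL : 0 < L) (hf : ∀ i, f i ^ L = 1)
    {p : ℝ} {μ : Measure (Config (G × ι))} (hμ : IsBernoulli p μ) (k : ℕ) :
    μ {ω | (cluster f ω).Infinite} ≤
      (b + 1) * (ENNReal.ofReal p * (((b ^ L - 1 : ℕ) : ℝ≥0∞) * ENNReal.ofReal p ^ L) ^ k) := by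
  classical
  let W : Finset (List (ι × Bool)) :=
    (Finset.univ.biUnion fun x => (blockWords L k x).image (x :: ·)).filter
      fun l => SelfAvoiding f l ∧ l.length = 1 + L * k
  have hW : W.card ≤ (b + 1) * (b ^ L - 1) ^ k := by
    refine (Finset.card_filter_le _ _).trans ((Finset.card_biUnion_le_card_mul _ _ _
      fun x _ => Finset.card_image_le.trans (card_blockWords_le hb L k x)).trans ?_)
    rw [Finset.card_univ, hb]
  have hsub : {ω | (cluster f ω).Infinite} ⊆
      ⋃ l ∈ W, {ω | ∀ e ∈ wordEdges f 1 l, ω e = true} := by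
    intro ω hω
    obtain ⟨l, hlen, hl, ho⟩ := exists_selfAvoiding_of_infinite hω (1 + L * k)
    simp only [Set.mem_iUnion]
    refine ⟨l, ?_, ho⟩
    rcases l with _ | ⟨x, u⟩
    · simp at hlen
      omega
    · have hu : u.length = L * k := by
        simp only [List.length_cons] at hlen
        omega
      simp only [W, Finset.mem_filter, Finset.mem_biUnion, Finset.mem_univ, true_and,
        Finset.mem_image]
      exact ⟨⟨x, u, hl.mem_blockWords hL hf hu, rfl⟩, hl, hlen⟩
  calc μ {ω | (cluster f ω).Infinite}
      ≤ ∑ l ∈ W, μ {ω | ∀ e ∈ wordEdges f 1 l, ω e = true} :=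
        (measure_mono hsub).trans (measure_biUnion_finset_le _ _)
    _ = ∑ l ∈ W, ENNReal.ofReal p ^ (1 + L * k) := by
        refine Finset.sum_congr rfl fun l hl => ?_
        obtain ⟨_, hl, hlen⟩ := Finset.mem_filter.1 hl
        rw [measure_selfAvoiding_open_eq hμ hl, hlen]
    _ = W.card * ENNReal.ofReal p ^ (1 + L * k) := by simp
    _ ≤ (((b + 1) * (b ^ L - 1) ^ k : ℕ) : ℝ≥0∞) * ENNReal.ofReal p ^ (1 + L * k) := by
        gcongr
    _ = _ := by
        push_cast
        rw [mul_pow, pow_add, pow_mul, pow_one]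
        ring

/-- A Cayley graph in which all generators have finite order has critical probability strictly
larger than that of the regular tree of the same degree. -/
theorem one_div_lt_pc_of_pow_eq_one [Fintype ι] {b L : ℕ}
    (hb : Fintype.card (ι × Bool) = b + 1) (hb2 : 2 ≤ b) (hL : 0 < L) (hf : ∀ i, f i ^ L = 1)
    {μ : ℝ → Measure (Config (G × ι))} (hμ : ∀ p ∈ Set.Icc (0 : ℝ) 1, IsBernoulli p (μ p)) :
    1 / (b : ℝ) < pc f μ := by
  have hb0 : (2 : ℝ) ≤ b := by exact_mod_cast hb2
  obtain ⟨p₀, ⟨hp₀b, hp₀1⟩, hp₀⟩ : ∃ p₀ : ℝ, p₀ ∈ Set.Ioo (1 / (b : ℝ)) 1 ∧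
      ((b ^ L - 1 : ℕ) : ℝ) * p₀ ^ L < 1 := by
    have hcont : Filter.Tendsto (fun p : ℝ => ((b ^ L - 1 : ℕ) : ℝ) * p ^ L)
        (nhdsWithin (1 / (b : ℝ)) (Set.Ioi (1 / (b : ℝ))))
        (nhds (((b ^ L - 1 : ℕ) : ℝ) * (1 / (b : ℝ)) ^ L)) :=
      ((by fun_prop : Continuous fun p : ℝ => ((b ^ L - 1 : ℕ) : ℝ) * p ^ L).tendsto _).mono_left
        nhdsWithin_le_nhds
    have hlt : ((b ^ L - 1 : ℕ) : ℝ) * (1 / (b : ℝ)) ^ L < 1 := by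
      rw [Nat.cast_sub (Nat.one_le_pow _ _ (by omega)), one_div, inv_pow, ← div_eq_mul_inv,
        div_lt_one (by positivity)]
      push_cast
      linarith
    have hb1 : 1 / (b : ℝ) < 1 := by
      rw [div_lt_one (by positivity)]
      linarith
    obtain ⟨p, h1, h2⟩ := ((hcont.eventually_lt_const hlt).and (Ioo_mem_nhdsGT hb1)).exists
    exact ⟨p, h2, h1⟩
  refine hp₀b.trans_le (le_csInf ⟨1, Or.inr rfl⟩ ?_)
  rintro p (⟨hp, hθ⟩ | rfl)
  · by_contra! hlt
    refine hθ.ne' ?_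
    rw [theta]
    have hr : ENNReal.ofReal (((b ^ L - 1 : ℕ) : ℝ) * p ^ L) < 1 := by
      rw [ENNReal.ofReal_lt_one]
      refine lt_of_le_of_lt ?_ hp₀
      have := hp.1
      gcongr
    rw [ENNReal.ofReal_mul (by positivity), ENNReal.ofReal_pow hp.1, ENNReal.ofReal_natCast] at hr
    have ht := ENNReal.tendsto_pow_atTop_nhds_zero_of_lt_one hr
    have ht' := ENNReal.Tendsto.const_mul (a := (b + 1 : ℝ≥0∞) * ENNReal.ofReal p) ht
      (Or.inr (by finiteness))
    rw [mul_zero] at ht'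
    have := ge_of_tendsto' ht' fun k => (measure_infinite_le hb hL hf (hμ p hp) k).trans_eq
      (mul_assoc _ _ _).symm
    rw [nonpos_iff_eq_zero.1 this, ENNReal.toReal_zero]
  · exact hp₀1.le

end Words

section Independence

variable {E : Type*} {p : ℝ} {μ : Measure (Config E)}

lemma measurableSet_openAt_pi (e : E) : MeasurableSet (openAt e) :=
  measurableSet_eq_fun (measurable_pi_apply e) measurable_const

/-- The σ-algebra generated by the states of the edges in `S`. -/
@[reducible]
def edgeAlgebra (S : Set E) : MeasurableSpace (Config E) :=
  ⨆ e ∈ S, MeasurableSpace.generateFrom {openAt e}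

lemma edgeAlgebra_mono {S T : Set E} (h : S ⊆ T) : edgeAlgebra S ≤ edgeAlgebra T :=
  biSup_mono h

lemma edgeAlgebra_le (S : Set E) : edgeAlgebra S ≤ MeasurableSpace.pi := by
  refine iSup₂_le fun e _ => MeasurableSpace.generateFrom_le ?_
  rintro _ rfl
  exact measurableSet_openAt_pi e

lemma measurableSet_openAt {S : Set E} {e : E} (he : e ∈ S) :
    MeasurableSet[edgeAlgebra S] (openAt e) :=
  le_iSup₂_of_le (f := fun e (_ : e ∈ S) => MeasurableSpace.generateFrom {openAt e}) e he le_rfl _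
    (MeasurableSpace.measurableSet_generateFrom rfl)

lemma IsBernoulli.indep_edgeAlgebra (hμ : IsBernoulli p μ) {S T : Set E} (h : Disjoint S T) :
    ProbabilityTheory.Indep (edgeAlgebra S) (edgeAlgebra T) μ := by
  have hind : ProbabilityTheory.iIndepSet (fun e : E => openAt e) μ := by
    rw [ProbabilityTheory.iIndepSet_iff_meas_biInter measurableSet_openAt_pi]
    intro F
    have h1 (e : E) : μ (openAt e) = ENNReal.ofReal p := by
      have := hμ.measure_forall_open {e}
      simpa [openAt] using this
    have h2 : ⋂ e ∈ F, openAt e = {ω : Config E | ∀ e ∈ F, ω e = true} := by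
      ext ω
      simp [openAt]
    rw [h2, hμ.measure_forall_open, Finset.prod_congr rfl fun e _ => h1 e, Finset.prod_const]
  refine ProbabilityTheory.indep_iSup_of_disjoint (fun e => ?_)
    ((ProbabilityTheory.iIndepSet_iff_iIndep _ _).1 hind) h
  refine MeasurableSpace.generateFrom_le ?_
  rintro _ rfl
  exact measurableSet_openAt_pi e

lemma IsBernoulli.measureReal_inter (hμ : IsBernoulli p μ) {S T : Set E} (h : Disjoint S T)
    {A B : Set (Config E)} (hA : MeasurableSet[edgeAlgebra S] A)
    (hB : MeasurableSet[edgeAlgebra T] B) : μ.real (A ∩ B) = μ.real A * μ.real B := by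
  simp only [Measure.real]
  rw [(ProbabilityTheory.Indep_iff _ _ _).1 (hμ.indep_edgeAlgebra h) A B hA hB,
    ENNReal.toReal_mul]

end Independence

section Branching

variable {G E κ : Type*} [Group G]

/-- Survival for `k` generations from the vertex `v` of a branching structure in which `v` has
the potential children `v * g a`, and `O a v` is the event that the child `v * g a` is born. -/
def survives (O : κ → G → Set (Config E)) (g : κ → G) : ℕ → G → Set (Config E)
  | 0, _ => Set.univ
  | k + 1, v => ⋃ a, O a v ∩ survives O g k (v * g a)

lemma survives_antitone (O : κ → G → Set (Config E)) (g : κ → G) (v : G) :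
    Antitone fun k => survives O g k v := by
  refine antitone_nat_of_succ_le fun k => ?_
  induction k generalizing v with
  | zero => exact Set.subset_univ _
  | succ k ih =>
    exact Set.iUnion_mono fun a => Set.inter_subset_inter_right _ (ih _)

lemma one_sub_pow_le_quadratic {ε : ℝ} (h0 : 0 ≤ ε) (h1 : ε ≤ 1) (k : ℕ) :
    (1 - ε) ^ k ≤ 1 - k * ε + k ^ 2 * ε ^ 2 := by
  induction k with
  | zero => simp
  | succ k ih =>
    rw [pow_succ]
    refine (mul_le_mul_of_nonneg_right ih (by linarith)).trans ?_
    have hk : (0 : ℝ) ≤ k := k.cast_nonneg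
    have : (0 : ℝ) ≤ (k + 1) * ε ^ 2 := by positivity
    have : (0 : ℝ) ≤ k ^ 2 * ε ^ 3 := by positivity
    push_cast
    nlinarith

variable [Fintype κ] {O : κ → G → Set (Config E)} {g : κ → G} {T V : G → Set E}

lemma measurableSet_survives (hO : ∀ a v, MeasurableSet[edgeAlgebra (T v)] (O a v))
    (hTV : ∀ v, T v ⊆ V v) (hV : ∀ v a, V (v * g a) ⊆ V v) (k : ℕ) (v : G) :
    MeasurableSet[edgeAlgebra (V v)] (survives O g k v) := by
  induction k generalizing v with
  | zero => exact MeasurableSet.univ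
  | succ k ih =>
    exact MeasurableSet.iUnion fun a => (edgeAlgebra_mono (hTV v) _ (hO a v)).inter
      (edgeAlgebra_mono (hV v a) _ (ih _))

/-- A supercritical branching structure with independent families survives with probability
bounded away from zero. -/
theorem exists_le_measureReal_survives {p : ℝ} {μ : Measure (Config E)} (hμ : IsBernoulli p μ)
    (hO : ∀ a v, MeasurableSet[edgeAlgebra (T v)] (O a v))
    (hTV : ∀ v, T v ⊆ V v) (hV : ∀ v a, V (v * g a) ⊆ V v)
    (hdT : ∀ v a, Disjoint (T v) (V (v * g a)))
    (hdV : ∀ v a b, a ≠ b → Disjoint (V (v * g a)) (V (v * g b)))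
    {M : ℝ} (hM : 1 < M) (hmean : ∀ v, M ≤ ∑ a, μ.real (O a v)) :
    ∃ ε > 0, ∀ k v, ε ≤ μ.real (survives O g k v) := by
  classical
  have := hμ.isProbabilityMeasure
  set C : ℝ := (Fintype.card κ : ℝ) with hC
  have hC0 : 0 ≤ C := Nat.cast_nonneg _
  set ε : ℝ := min 1 ((M - 1) / (C ^ 2 + 1)) with hε
  have hε0 : 0 < ε := lt_min one_pos (div_pos (by linarith) (by positivity))
  have hε1 : ε ≤ 1 := min_le_left _ _
  have hεM : C ^ 2 * ε ≤ M - 1 := by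
    have : ε ≤ (M - 1) / (C ^ 2 + 1) := min_le_right _ _
    rw [le_div_iff₀ (by positivity)] at this
    nlinarith
  refine ⟨ε, hε0, fun k => ?_⟩
  induction k with
  | zero => simpa [survives] using hε1
  | succ k ih =>
    intro v
    have hS (a : κ) := measurableSet_survives hO hTV hV k (v * g a)
    let D (F : Finset κ) : Set (Config E) := ⋂ a ∈ F, (survives O g k (v * g a))ᶜ
    let P (F : Finset κ) : Set (Config E) := {ω | ∀ a, ω ∈ O a v ↔ a ∈ F}
    have hP (F : Finset κ) : MeasurableSet[edgeAlgebra (T v)] (P F) := by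
      have : P F = ⋂ a, if a ∈ F then O a v else (O a v)ᶜ := by
        ext ω
        simp only [P, Set.mem_ofPred_eq, Set.mem_iInter]
        refine forall_congr' fun a => ?_
        split_ifs with h <;> simp [h]
      rw [this]
      refine MeasurableSet.iInter fun a => ?_
      split_ifs
      · exact hO a v
      · exact (hO a v).compl
    have hD (F : Finset κ) : MeasurableSet[edgeAlgebra (⋃ a ∈ F, V (v * g a))] (D F) :=
      Finset.measurableSet_biInter F fun a ha =>
        (edgeAlgebra_mono (Set.subset_biUnion_of_mem (u := fun a => V (v * g a)) ha) _
          (hS a)).compl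
    have hDle (F : Finset κ) : μ.real (D F) ≤ (1 - ε) ^ F.card := by
      induction F using Finset.induction_on with
      | empty => simp [D]
      | insert a F ha ihF =>
        have hins : D (insert a F) = (survives O g k (v * g a))ᶜ ∩ D F := by
          simp [D, Finset.set_biInter_insert]
        rw [hins, hμ.measureReal_inter (S := V (v * g a)) ?_ (hS a).compl (hD F),
          Finset.card_insert_of_notMem ha, pow_succ',
          probReal_compl_eq_one_sub (edgeAlgebra_le _ _ (hS a))]
        · gcongr
          exact ih _
        · refine Set.disjoint_iUnion₂_right.2 fun b hb => hdV v a b ?_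
          rintro rfl
          exact ha hb
    have hdisj : (↑(Finset.univ : Finset (Finset κ)) : Set (Finset κ)).PairwiseDisjoint P := by
      intro F _ F' _ hne
      refine Set.disjoint_left.2 fun ω h h' => hne ?_
      ext a
      rw [← h a, h' a]
    have hcover (ω : Config E) : ω ∈ P (Finset.univ.filter fun a => ω ∈ O a v) := by
      intro a
      simp
    have hcompl : (survives O g (k + 1) v)ᶜ ⊆ ⋃ F ∈ (Finset.univ : Finset (Finset κ)),
        P F ∩ D F := by
      intro ω hω
      refine Set.mem_iUnion₂.2 ⟨_, Finset.mem_univ _, hcover ω, ?_⟩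
      simp only [survives, Set.mem_compl_iff, Set.mem_iUnion, Set.mem_inter_iff, not_exists,
        not_and] at hω
      simpa [D] using hω
    have hle : μ.real (survives O g (k + 1) v)ᶜ ≤
        ∑ F : Finset κ, μ.real (P F) * (1 - F.card * ε + C ^ 2 * ε ^ 2) := by
      refine (measureReal_mono hcompl (measure_ne_top _ _)).trans
        ((measureReal_biUnion_finset_le _ _).trans (Finset.sum_le_sum fun F _ => ?_))
      rw [hμ.measureReal_inter (Set.disjoint_iUnion₂_right.2 fun a _ => hdT v a) (hP F) (hD F)]
      refine mul_le_mul_of_nonneg_left ((hDle F).trans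
        ((one_sub_pow_le_quadratic hε0.le hε1 _).trans ?_)) measureReal_nonneg
      have : (F.card : ℝ) ≤ C := by
        rw [hC]
        exact_mod_cast Finset.card_le_univ F
      gcongr
    have hone : ∑ F : Finset κ, μ.real (P F) = 1 := by
      rw [← measureReal_biUnion_finset hdisj fun F _ => edgeAlgebra_le _ _ (hP F)]
      have : ⋃ F ∈ (Finset.univ : Finset (Finset κ)), P F = Set.univ :=
        Set.eq_univ_of_forall fun ω => Set.mem_iUnion₂.2 ⟨_, Finset.mem_univ _, hcover ω⟩
      rw [this, probReal_univ]
    have hcard : ∑ F : Finset κ, μ.real (P F) * F.card = ∑ a, μ.real (O a v) := by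
      have h1 (a : κ) : μ.real (O a v) = ∑ F : Finset κ, if a ∈ F then μ.real (P F) else 0 := by
        rw [← Finset.sum_filter, ← measureReal_biUnion_finset
          (hdisj.subset (Finset.coe_subset.2 (Finset.filter_subset _ _)))
          fun F _ => edgeAlgebra_le _ _ (hP F)]
        congr 1
        ext ω
        simp only [Set.mem_iUnion, Finset.mem_filter, Finset.mem_univ, true_and, exists_prop]
        exact ⟨fun h => ⟨_, (hcover ω a).1 h, hcover ω⟩, fun ⟨F, h, hF⟩ => (hF a).2 h⟩
      rw [Finset.sum_congr rfl fun a _ => h1 a, Finset.sum_comm]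
      refine Finset.sum_congr rfl fun F _ => ?_
      simp [mul_comm]
    have hrw : ∑ F : Finset κ, μ.real (P F) * (1 - F.card * ε + C ^ 2 * ε ^ 2) =
        1 + C ^ 2 * ε ^ 2 - ε * ∑ a, μ.real (O a v) := by
      rw [← hcard, Finset.mul_sum, ← mul_one (1 + C ^ 2 * ε ^ 2), ← hone, Finset.mul_sum,
        ← Finset.sum_sub_distrib]
      exact Finset.sum_congr rfl fun F _ => by ring
    rw [hrw, probReal_compl_eq_one_sub
      (edgeAlgebra_le _ _ (measurableSet_survives hO hTV hV (k + 1) v))] at hle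
    have h2 := mul_le_mul_of_nonneg_left (hmean v) hε0.le
    nlinarith [mul_le_mul_of_nonneg_left hεM hε0.le]

end Branching

variable {G ι : Type*} [Group G]

/-- The function `N` behaves like the normal form, as a list of syllables `(i, k)` standing for
the powers `f i ^ k`, in the free product of cyclic groups of orders `ord i` generated
by `f i`. -/
structure IsNormalForm (f : ι → G) (ord : ι → ℕ) (N : G → List (ι × ℕ)) : Prop where
  pow_ord : ∀ i, f i ^ ord i = 1
  one : N 1 = []
  pow_mul : ∀ i k q, 0 < k → k < ord i → (∀ x ∈ (N q).head?, x.1 ≠ i) →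
    N (f i ^ k * q) = (i, k) :: N q

/-- The event that, on the cycle through `v` spanned by the generator `f i` of order `m`, one of
the two arcs between `v` and `v * f i ^ x` is open. -/
def arcOpen (f : ι → G) (i : ι) (m x : ℕ) (v : G) : Set (Config (G × ι)) :=
  {ω | ∀ y ∈ Finset.range x, ω (v * f i ^ y, i) = true} ∪
    {ω | ∀ y ∈ Finset.Ico x m, ω (v * f i ^ y, i) = true}

lemma conn_pow_add {f : ι → G} {i : ι} {ω : Config (G × ι)} {v : G} (x d : ℕ)
    (h : ∀ y ∈ Finset.Ico x (x + d), ω (v * f i ^ y, i) = true) :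
    Conn f ω (v * f i ^ x) (v * f i ^ (x + d)) := by
  induction d with
  | zero => exact Relation.ReflTransGen.refl
  | succ d ih =>
    refine (ih fun y hy => h y ?_).tail ⟨i, Or.inl ⟨h _ ?_, ?_⟩⟩
    · simp only [Finset.mem_Ico] at hy ⊢
      omega
    · simp
    · rw [← add_assoc, pow_succ, mul_assoc]

lemma Conn.symm {f : ι → G} {ω : Config (G × ι)} {v w : G} (h : Conn f ω v w) :
    Conn f ω w v := by
  have : Std.Symm (Step f ω) := ⟨fun _ _ ⟨i, h⟩ => ⟨i, h.symm⟩⟩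
  exact Relation.ReflTransGen.stdSymm.symm _ _ h

lemma conn_of_mem_arcOpen {f : ι → G} {i : ι} {m x : ℕ} (hx : x ≤ m) (hm : f i ^ m = 1) {v : G}
    {ω : Config (G × ι)} (h : ω ∈ arcOpen f i m x v) : Conn f ω v (v * f i ^ x) := by
  rcases h with h | h
  · have := conn_pow_add (f := f) (i := i) (ω := ω) (v := v) 0 x
      fun y hy => h y (by simpa using hy)
    simpa using this
  · obtain ⟨d, rfl⟩ := Nat.exists_eq_add_of_le hx
    have := (conn_pow_add x d h).symm
    simpa [hm] using this

lemma measurableSet_arcOpen {f : ι → G} {i : ι} {m x : ℕ} {v : G} (hx : x ≤ m)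
    {S : Set (G × ι)} (hS : ∀ y < m, (v * f i ^ y, i) ∈ S) :
    MeasurableSet[edgeAlgebra S] (arcOpen f i m x v) := by
  have key (J : Finset ℕ) (hJ : ∀ y ∈ J, y < m) :
      MeasurableSet[edgeAlgebra S] {ω : Config (G × ι) | ∀ y ∈ J, ω (v * f i ^ y, i) = true} := by
    have : {ω : Config (G × ι) | ∀ y ∈ J, ω (v * f i ^ y, i) = true} =
        ⋂ y ∈ J, openAt (v * f i ^ y, i) := by
      ext ω
      simp [openAt]
    rw [this]
    exact Finset.measurableSet_biInter J fun y hy => measurableSet_openAt (hS y (hJ y hy))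
  refine (key _ fun y hy => ?_).union (key _ fun y hy => ?_)
  · exact (Finset.mem_range.1 hy).trans_le hx
  · exact (Finset.mem_Ico.1 hy).2

/-- The expected number of other vertices of a cycle of length `k + 1` joined to a given one. -/
noncomputable def arcMean (k : ℕ) (p : ℝ) : ℝ :=
  ∑ x ∈ Finset.range k, (p ^ (x + 1) + p ^ (k - x) - p ^ (k + 1))

namespace IsNormalForm

variable {f : ι → G} {ord : ι → ℕ} {N : G → List (ι × ℕ)}

lemma pow (hN : IsNormalForm f ord N) {i : ι} {k : ℕ} (h0 : 0 < k) (hk : k < ord i) :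
    N (f i ^ k) = [(i, k)] := by
  have := hN.pow_mul i k 1 h0 hk (by simp [hN.one])
  simpa [hN.one] using this

lemma pow_injOn (hN : IsNormalForm f ord N) (i : ι) :
    Set.InjOn (fun k => f i ^ k) (Set.Iio (ord i)) := by
  intro x hx y hy hxy
  have h := congrArg N hxy
  rcases Nat.eq_zero_or_pos x with rfl | hx0 <;> rcases Nat.eq_zero_or_pos y with rfl | hy0
  · rfl
  · simp [hN.one, hN.pow hy0 hy] at h
  · simp [hN.one, hN.pow hx0 hx] at h
  · simpa [hN.pow hx0 hx, hN.pow hy0 hy] using h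

lemma measureReal_forall_open (hN : IsNormalForm f ord N) {p : ℝ} (hp : 0 ≤ p)
    {μ : Measure (Config (G × ι))} (hμ : IsBernoulli p μ) (i : ι) (v : G) {J : Finset ℕ}
    (hJ : ∀ y ∈ J, y < ord i) :
    μ.real {ω | ∀ y ∈ J, ω (v * f i ^ y, i) = true} = p ^ J.card := by
  classical
  have h := hμ.measure_forall_open (J.image fun y => (v * f i ^ y, i))
  rw [Finset.card_image_of_injOn] at h
  · simp only [Finset.forall_mem_image] at h
    rw [Measure.real, h, ENNReal.toReal_pow, ENNReal.toReal_ofReal hp]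
  · intro x hx y hy hxy
    simp only [Prod.mk.injEq, mul_right_inj, and_true] at hxy
    exact hN.pow_injOn i (hJ x hx) (hJ y hy) hxy

lemma measureReal_arcOpen (hN : IsNormalForm f ord N) {p : ℝ} (hp : 0 ≤ p)
    {μ : Measure (Config (G × ι))} (hμ : IsBernoulli p μ) (i : ι) (v : G) {x : ℕ}
    (hx : x ≤ ord i) :
    μ.real (arcOpen f i (ord i) x v) = p ^ x + p ^ (ord i - x) - p ^ ord i := by
  have := hμ.isProbabilityMeasure
  have h1 := hN.measureReal_forall_open hp hμ i v (J := Finset.range x)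
    fun y hy => (Finset.mem_range.1 hy).trans_le hx
  have h2 := hN.measureReal_forall_open hp hμ i v (J := Finset.Ico x (ord i))
    fun y hy => (Finset.mem_Ico.1 hy).2
  have h3 := hN.measureReal_forall_open hp hμ i v (J := Finset.range (ord i))
    fun y hy => Finset.mem_range.1 hy
  have hm : MeasurableSet
      {ω : Config (G × ι) | ∀ y ∈ Finset.Ico x (ord i), ω (v * f i ^ y, i) = true} := by
    have : {ω : Config (G × ι) | ∀ y ∈ Finset.Ico x (ord i), ω (v * f i ^ y, i) = true} =
        ⋂ y ∈ Finset.Ico x (ord i), openAt (v * f i ^ y, i) := by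
      ext ω
      simp [openAt]
    rw [this]
    exact Finset.measurableSet_biInter _ fun y _ => measurableSet_openAt_pi _
  have hinter : {ω : Config (G × ι) | ∀ y ∈ Finset.range x, ω (v * f i ^ y, i) = true} ∩
      {ω | ∀ y ∈ Finset.Ico x (ord i), ω (v * f i ^ y, i) = true} =
      {ω | ∀ y ∈ Finset.range (ord i), ω (v * f i ^ y, i) = true} := by
    ext ω
    simp only [Finset.mem_range, Finset.mem_Ico, Set.mem_inter_iff, Set.mem_ofPred_eq]
    refine ⟨fun h y hy => ?_, fun h => ⟨fun y hy => h y (by omega), fun y hy => h y hy.2⟩⟩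
    rcases lt_or_ge y x with hyx | hyx
    · exact h.1 y hyx
    · exact h.2 y ⟨hyx, hy⟩
  have := measureReal_union_add_inter (μ := μ)
    (s := {ω : Config (G × ι) | ∀ y ∈ Finset.range x, ω (v * f i ^ y, i) = true}) hm
  rw [hinter, h1, h2, h3, Finset.card_range, Finset.card_range, Nat.card_Ico] at this
  rw [arcOpen]
  linarith

/-- The edges which, relative to a vertex `v`, belong to the part of the graph hanging off `v`
through its cycle of type `s`. -/
def branchEdges (N : G → List (ι × ℕ)) (s : ι) (v : G) : Set (G × ι) :=
  {e | (∃ x ∈ (N (v⁻¹ * e.1)).head?, x.1 = s) ∨ (N (v⁻¹ * e.1) = [] ∧ e.2 = s)}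

/-- The edges of the cycle of type `s` through `v`, and of the cycles of type `t` through the
other vertices of that cycle. -/
def blockEdges (f : ι → G) (ord : ι → ℕ) (s t : ι) (v : G) : Set (G × ι) :=
  {e | (∃ y < ord s, e = (v * f s ^ y, s)) ∨
    ∃ x, 0 < x ∧ x < ord s ∧ ∃ y < ord t, e = (v * f s ^ x * f t ^ y, t)}

section

variable {s t : ι}

lemma pow_mul_pow_mul (hN : IsNormalForm f ord N) (hst : s ≠ t) {x y : ℕ} (hx0 : 0 < x)
    (hx : x < ord s) (hy0 : 0 < y) (hy : y < ord t) {q : G} (hq : ∀ z ∈ (N q).head?, z.1 ≠ t) :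
    N (f s ^ x * f t ^ y * q) = (s, x) :: (t, y) :: N q := by
  have h := hN.pow_mul t y q hy0 hy hq
  rw [mul_assoc, hN.pow_mul s x _ hx0 hx (by simp [h, hst.symm]), h]

lemma head_ne_of_mem_branchEdges (hst : s ≠ t) {v : G} {e : G × ι}
    (he : e ∈ branchEdges N s v) : ∀ z ∈ (N (v⁻¹ * e.1)).head?, z.1 ≠ t := by
  rintro z hz rfl
  rcases he with ⟨x, hx, rfl⟩ | ⟨h, -⟩
  · rw [Option.mem_unique hz hx] at hst
    exact hst rfl
  · simp [h] at hz

lemma blockEdges_subset (hN : IsNormalForm f ord N) (hst : s ≠ t) (v : G) :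
    blockEdges f ord s t v ⊆ branchEdges N s v := by
  rintro e (⟨y, hy, rfl⟩ | ⟨x, hx0, hx, y, hy, rfl⟩)
  · rcases Nat.eq_zero_or_pos y with rfl | hy0
    · exact Or.inr (by simp [hN.one])
    · exact Or.inl (by simp [hN.pow hy0 hy])
  · left
    rcases Nat.eq_zero_or_pos y with rfl | hy0
    · simp [hN.pow hx0 hx]
    · have := hN.pow_mul_pow_mul hst hx0 hx hy0 hy (q := 1) (by simp [hN.one])
      rw [mul_one] at this
      simp [mul_assoc, this]

lemma normalForm_of_mem_branchEdges_child (hN : IsNormalForm f ord N) (hst : s ≠ t) {x y : ℕ}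
    (hx0 : 0 < x) (hx : x < ord s) (hy0 : 0 < y) (hy : y < ord t) {v : G} {e : G × ι}
    (he : e ∈ branchEdges N s (v * (f s ^ x * f t ^ y))) :
    N (v⁻¹ * e.1) = (s, x) :: (t, y) :: N ((v * (f s ^ x * f t ^ y))⁻¹ * e.1) := by
  rw [← hN.pow_mul_pow_mul hst hx0 hx hy0 hy (head_ne_of_mem_branchEdges hst he)]
  congr 1
  group

lemma disjoint_blockEdges_branchEdges (hN : IsNormalForm f ord N) (hst : s ≠ t) {x y : ℕ}
    (hx0 : 0 < x) (hx : x < ord s) (hy0 : 0 < y) (hy : y < ord t) (v : G) :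
    Disjoint (blockEdges f ord s t v) (branchEdges N s (v * (f s ^ x * f t ^ y))) := by
  refine Set.disjoint_left.2 fun e he he' => ?_
  have h := hN.normalForm_of_mem_branchEdges_child hst hx0 hx hy0 hy he'
  rcases he with ⟨z, hz, rfl⟩ | ⟨w, hw0, hw, z, hz, rfl⟩
  · rcases Nat.eq_zero_or_pos z with rfl | hz0
    · simp [hN.one] at h
    · simp [hN.pow hz0 hz] at h
  · rcases Nat.eq_zero_or_pos z with rfl | hz0
    · simp [hN.pow hw0 hw] at h
    · have h' := hN.pow_mul_pow_mul hst hw0 hw hz0 hz (q := 1) (by simp [hN.one])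
      rw [mul_one] at h'
      simp only [mul_assoc, inv_mul_cancel_left, h', hN.one, List.cons.injEq] at h
      rcases he' with ⟨a, ha, -⟩ | ⟨-, he'⟩
      · have h0 := h.2.2
        simp only [mul_assoc] at ha
        rw [← h0] at ha
        simp at ha
      · exact hst he'.symm

lemma disjoint_branchEdges_branchEdges (hN : IsNormalForm f ord N) (hst : s ≠ t)
    {x y x' y' : ℕ} (hx0 : 0 < x) (hx : x < ord s) (hy0 : 0 < y) (hy : y < ord t)
    (hx0' : 0 < x') (hx' : x' < ord s) (hy0' : 0 < y') (hy' : y' < ord t)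
    (hne : (x, y) ≠ (x', y')) (v : G) :
    Disjoint (branchEdges N s (v * (f s ^ x * f t ^ y)))
      (branchEdges N s (v * (f s ^ x' * f t ^ y'))) := by
  refine Set.disjoint_left.2 fun e he he' => hne ?_
  have h := hN.normalForm_of_mem_branchEdges_child hst hx0 hx hy0 hy he
  rw [hN.normalForm_of_mem_branchEdges_child hst hx0' hx' hy0' hy' he'] at h
  simp only [List.cons.injEq, Prod.mk.injEq, true_and] at h
  simp [h.1, h.2.1]

lemma exists_conn_of_mem_survives (hN : IsNormalForm f ord N) (hst : s ≠ t) {a b : ℕ}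
    (hs : ord s = a + 1) (ht : ord t = b + 1) {ω : Config (G × ι)} (k : ℕ) {v : G}
    (h : ω ∈ survives (fun (c : Fin a × Fin b) v => arcOpen f s (a + 1) (c.1 + 1) v ∩
      arcOpen f t (b + 1) (c.2 + 1) (v * f s ^ (c.1 + 1 : ℕ)))
      (fun c => f s ^ (c.1 + 1 : ℕ) * f t ^ (c.2 + 1 : ℕ)) k v) :
    ∃ q, Conn f ω v (v * q) ∧ (N q).length = 2 * k ∧ ∀ z ∈ (N q).head?, z.1 ≠ t := by
  induction k generalizing v with
  | zero => exact ⟨1, by rw [mul_one]; exact Relation.ReflTransGen.refl, by simp [hN.one]⟩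
  | succ k ih =>
    simp only [survives, Set.mem_iUnion] at h
    obtain ⟨⟨x, y⟩, ⟨h1, h2⟩, h3⟩ := h
    obtain ⟨q, hq, hlen, hhead⟩ := ih h3
    have hx := x.2
    have hy := y.2
    have hNq := hN.pow_mul_pow_mul hst (x := x + 1) (y := y + 1) (by omega) (by omega) (by omega)
      (by omega) hhead
    refine ⟨f s ^ (x + 1 : ℕ) * f t ^ (y + 1 : ℕ) * q, ?_, ?_, ?_⟩
    · refine (conn_of_mem_arcOpen (by omega) (hs ▸ hN.pow_ord s) h1).trans
        ((conn_of_mem_arcOpen (by omega) (ht ▸ hN.pow_ord t) h2).trans ?_)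
      simp only [mul_assoc] at hq ⊢
      exact hq
    · rw [hNq]
      simp [hlen]
      omega
    · rw [hNq]
      simp [hst]

/-- If the mean number of connections inside the cycles of the two types have product larger
than one, then percolation occurs. -/
theorem theta_pos (hN : IsNormalForm f ord N) (hst : s ≠ t) {a b : ℕ}
    (hs : ord s = a + 1) (ht : ord t = b + 1) {p : ℝ} (hp : 0 ≤ p)
    {μ : Measure (Config (G × ι))} (hμ : IsBernoulli p μ)
    (hmean : 1 < arcMean a p * arcMean b p) : 0 < theta f μ := by
  have := hμ.isProbabilityMeasure
  set O : Fin a × Fin b → G → Set (Config (G × ι)) := fun c v =>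
    arcOpen f s (a + 1) (c.1 + 1) v ∩ arcOpen f t (b + 1) (c.2 + 1) (v * f s ^ (c.1 + 1 : ℕ))
    with hO
  set g : Fin a × Fin b → G := fun c => f s ^ (c.1 + 1 : ℕ) * f t ^ (c.2 + 1 : ℕ) with hg
  have hOm (c : Fin a × Fin b) (v : G) :
      MeasurableSet[edgeAlgebra (blockEdges f ord s t v)] (O c v) := by
    refine (measurableSet_arcOpen (by omega) fun y hy => ?_).inter
      (measurableSet_arcOpen (by omega) fun y hy => ?_)
    · exact Or.inl ⟨y, by omega, rfl⟩
    · exact Or.inr ⟨c.1 + 1, by omega, by omega, y, by omega, rfl⟩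
  have hVV (v : G) (c : Fin a × Fin b) : branchEdges N s (v * g c) ⊆ branchEdges N s v := by
    intro e he
    have := hN.normalForm_of_mem_branchEdges_child hst (x := c.1 + 1) (y := c.2 + 1) (by omega)
      (by omega) (by omega) (by omega) he
    exact Or.inl (by simp [this])
  have hprod (v : G) : ∑ c, μ.real (O c v) = arcMean a p * arcMean b p := by
    have h1 (c : Fin a × Fin b) : μ.real (O c v) =
        (p ^ (c.1 + 1 : ℕ) + p ^ (a - c.1) - p ^ (a + 1)) *
          (p ^ (c.2 + 1 : ℕ) + p ^ (b - c.2) - p ^ (b + 1)) := by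
      have e1 := hN.measureReal_arcOpen hp hμ s v (x := c.1 + 1) (by omega)
      have e2 := hN.measureReal_arcOpen hp hμ t (v * f s ^ (c.1 + 1 : ℕ)) (x := c.2 + 1)
        (by omega)
      rw [hs, Nat.add_sub_add_right] at e1
      rw [ht, Nat.add_sub_add_right] at e2
      rw [hO, hμ.measureReal_inter (S := {e | e.2 = s}) (T := {e | e.2 = t}) ?_
        (measurableSet_arcOpen (by omega) fun y _ => rfl)
        (measurableSet_arcOpen (by omega) fun y _ => rfl), e1, e2]
      exact Set.disjoint_left.2 fun e h h' => hst (h.symm.trans h')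
    rw [Finset.sum_congr rfl fun c _ => h1 c, arcMean, arcMean, ← Fin.sum_univ_eq_sum_range
      (fun x => p ^ (x + 1) + p ^ (a - x) - p ^ (a + 1)), ← Fin.sum_univ_eq_sum_range
      (fun x => p ^ (x + 1) + p ^ (b - x) - p ^ (b + 1)), Finset.sum_mul_sum,
      Fintype.sum_prod_type]
  obtain ⟨ε, hε, hsurv⟩ := exists_le_measureReal_survives (O := O) (g := g)
    (T := blockEdges f ord s t) (V := branchEdges N s) hμ hOm
    (fun v => hN.blockEdges_subset hst v) hVV
    (fun v c => hN.disjoint_blockEdges_branchEdges hst (by omega) (by omega) (by omega)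
      (by omega) v)
    (fun v c d hcd => hN.disjoint_branchEdges_branchEdges hst (by omega) (by omega) (by omega)
      (by omega) (by omega) (by omega) (by omega) (by omega)
      (fun h => hcd (by
        simp only [Prod.mk.injEq] at h
        exact Prod.ext (Fin.ext (by omega)) (Fin.ext (by omega)))) v)
    hmean (fun v => (hprod v).ge)
  have hmeas (k : ℕ) : MeasurableSet (survives O g k 1) :=
    edgeAlgebra_le _ _ (measurableSet_survives hOm (fun v => hN.blockEdges_subset hst v) hVV k 1)
  have hsub : ⋂ k, survives O g k 1 ⊆ {ω | (cluster f ω).Infinite} := by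
    intro ω hω hfin
    obtain ⟨B, hB⟩ := (hfin.image fun q => (N q).length).bddAbove
    obtain ⟨q, hq, hlen, -⟩ := hN.exists_conn_of_mem_survives hst hs ht (B + 1)
      (Set.mem_iInter.1 hω (B + 1))
    have := hB ⟨q, by simpa [cluster] using hq, rfl⟩
    simp only [hlen] at this
    omega
  have hlim := tendsto_measure_iInter_atTop (μ := μ) (fun k => (hmeas k).nullMeasurableSet)
    (survives_antitone O g 1) ⟨0, measure_ne_top _ _⟩
  have hle : ENNReal.ofReal ε ≤ μ (⋂ k, survives O g k 1) :=
    ge_of_tendsto' hlim fun k => ENNReal.ofReal_le_of_le_toReal (hsurv k 1)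
  exact ENNReal.toReal_pos (((ENNReal.ofReal_pos.2 hε).trans_le
    (hle.trans (measure_mono hsub))).ne') (measure_ne_top _ _)

end

end IsNormalForm

end Perc

namespace Perc

section ArcMean

lemma continuous_arcMean (k : ℕ) : Continuous (arcMean k) := by
  unfold arcMean
  fun_prop

lemma arcMean_eq (k : ℕ) (p : ℝ) :
    arcMean k p = 2 * ∑ x ∈ Finset.range k, p ^ (x + 1) - k * p ^ (k + 1) := by
  have h : ∑ x ∈ Finset.range k, p ^ (k - x) = ∑ x ∈ Finset.range k, p ^ (x + 1) := by
    rw [← Finset.sum_range_reflect]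
    refine Finset.sum_congr rfl fun x hx => ?_
    have := Finset.mem_range.1 hx
    congr 1
    omega
  simp only [arcMean, Finset.sum_sub_distrib, Finset.sum_add_distrib, h, Finset.sum_const,
    Finset.card_range, nsmul_eq_mul]
  ring

lemma arcMean_succ (k : ℕ) (p : ℝ) :
    arcMean (k + 1) p = arcMean k p + p ^ (k + 1) * (k + 2 - (k + 1) * p) := by
  rw [arcMean_eq, arcMean_eq, Finset.sum_range_succ]
  push_cast
  ring

lemma arcMean_mono {p : ℝ} (h0 : 0 ≤ p) (h1 : p ≤ 1) : Monotone fun k => arcMean k p := by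
  refine monotone_nat_of_le_succ fun k => ?_
  rw [arcMean_succ]
  have : (0 : ℝ) ≤ k + 2 - (k + 1) * p := by nlinarith [k.cast_nonneg (α := ℝ)]
  have := mul_nonneg (pow_nonneg h0 (k + 1)) this
  linarith

lemma one_sub_mul_arcMean (k : ℕ) (p : ℝ) :
    (1 - p) * arcMean k p = 2 * p * (1 - p ^ k) - k * p ^ (k + 1) * (1 - p) := by
  induction k with
  | zero => simp [arcMean]
  | succ k ih =>
    rw [arcMean_succ, mul_add, ih]
    push_cast
    ring

lemma three_sevenths_pow_mul_lt {k : ℕ} (hk : 2 ≤ k) :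
    (3 / 7 : ℝ) ^ k * ((k + 3) * (k + 1)) < 3 := by
  induction k, hk using Nat.le_induction with
  | base => norm_num
  | succ k hk ih =>
    have hk' : (2 : ℝ) ≤ k := by exact_mod_cast hk
    refine lt_of_le_of_lt ?_ ih
    rw [pow_succ, mul_assoc]
    refine mul_le_mul_of_nonneg_left ?_ (by positivity)
    push_cast
    nlinarith

lemma one_lt_arcMean {k : ℕ} (hk : 2 ≤ k) : 1 < arcMean k ((k + 1) / (3 * k + 1)) := by
  have hk' : (2 : ℝ) ≤ k := by exact_mod_cast hk
  set p : ℝ := (k + 1) / (3 * k + 1) with hp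
  have hden : (0 : ℝ) < 3 * k + 1 := by positivity
  have hp0 : 0 < p := by positivity
  have hp3 : 1 / 3 ≤ p := by
    rw [hp, div_le_div_iff₀ (by norm_num) hden]
    linarith
  have hp7 : p ≤ 3 / 7 := by
    rw [hp, div_le_div_iff₀ hden (by norm_num)]
    linarith
  have hpk : p ^ k * ((k + 3) * (k + 1)) < 3 :=
    (mul_le_mul_of_nonneg_right (pow_le_pow_left₀ hp0.le hp7 k) (by positivity)).trans_lt
      (three_sevenths_pow_mul_lt hk)
  have hlin : (3 * p - 1) * (k + 1) = 2 * p := by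
    rw [hp]
    field_simp
    ring
  have hid := one_sub_mul_arcMean k p
  have h1 : p ^ k * (2 + k * (1 - p)) * (k + 1) < 2 := by
    have : p ^ k * ((2 + k * (1 - p)) * (k + 1)) ≤ p ^ k * ((2 + k * (2 / 3)) * (k + 1)) := by
      gcongr
      linarith
    nlinarith
  have h2 : p ^ (k + 1) * (2 + k * (1 - p)) < 3 * p - 1 := by
    have : p ^ (k + 1) * (2 + k * (1 - p)) * (k + 1) < (3 * p - 1) * (k + 1) := by
      rw [hlin, pow_succ]
      nlinarith
    exact lt_of_mul_lt_mul_right this (by positivity)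
  have h3 : (1 - p) * 1 < (1 - p) * arcMean k p := by
    rw [hid]
    rw [pow_succ] at h2 ⊢
    linarith
  exact lt_of_mul_lt_mul_left h3 (by linarith)

end ArcMean

section Cheeger

variable {G ι : Type*} [Group G]

lemma cheeger_nonneg (f : ι → G) : 0 ≤ cheeger f :=
  Real.iInf_nonneg fun _ => by positivity

/-- In a Cayley graph as many edges enter a finite set as leave it, so that the Cheeger constant
is bounded by twice the number of leaving edges per vertex. -/
lemma cheeger_le_of_leaving_subset [Fintype ι] (f : ι → G) {K : Finset G} (hK : K.Nonempty)
    (B : Finset (G × ι)) (hB : ∀ a ∈ K, ∀ i, a * f i ∉ K → (a, i) ∈ B) :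
    cheeger f ≤ 2 * B.card / K.card := by
  classical
  let A : Finset (G × ι) := K ×ˢ Finset.univ
  let A' : Finset (G × ι) := A.image fun e => (e.1 * (f e.2)⁻¹, e.2)
  have hA' (e : G × ι) : e ∈ A' ↔ e.1 * f e.2 ∈ K := by
    simp only [A', A, Finset.mem_image, Finset.mem_product, Finset.mem_univ, and_true]
    constructor
    · rintro ⟨x, hx, rfl⟩
      simpa using hx
    · exact fun h => ⟨(e.1 * f e.2, e.2), h, by simp⟩
  have hA (e : G × ι) : e ∈ A ↔ e.1 ∈ K := by simp [A]
  have hcard : A.card = A'.card := by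
    refine (Finset.card_image_of_injective _ ?_).symm
    rintro ⟨a, i⟩ ⟨b, j⟩ h
    simp only [Prod.mk.injEq] at h
    obtain ⟨h1, rfl⟩ := h
    simpa using h1
  have hsub : A \ A' ⊆ B := by
    rintro ⟨a, i⟩ h
    rw [Finset.mem_sdiff, hA, hA'] at h
    exact hB a h.1 i h.2
  have hboundary : Nat.card {e : G × ι // Xor (e.1 ∈ K) (e.1 * f e.2 ∈ K)} ≤ 2 * B.card := by
    have h1 : Nat.card {e : G × ι // Xor (e.1 ∈ K) (e.1 * f e.2 ∈ K)} =
        ((A \ A') ∪ (A' \ A)).card := by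
      rw [← Nat.card_eq_finsetCard]
      refine Nat.card_congr (Equiv.subtypeEquivRight fun e => ?_)
      simp [Xor, Finset.mem_union, Finset.mem_sdiff, hA, hA']
    rw [h1, two_mul]
    refine (Finset.card_union_le _ _).trans (add_le_add (Finset.card_le_card hsub) ?_)
    rw [← Finset.card_sdiff_comm hcard]
    exact Finset.card_le_card hsub
  refine (ciInf_le ⟨0, ?_⟩ (⟨K, hK⟩ : {K : Finset G // K.Nonempty})).trans ?_
  · rintro _ ⟨K', rfl⟩
    positivity
  · dsimp only
    gcongr
    exact_mod_cast hboundary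

end Cheeger

namespace IsNormalForm

variable {G ι : Type*} [Group G] {f : ι → G} {ord : ι → ℕ} {N : G → List (ι × ℕ)} {s t : ι}

lemma chain_mul (hN : IsNormalForm f ord N) (hst : s ≠ t) (hs : 2 ≤ ord s) (ht : 2 ≤ ord t)
    (j : ℕ) {q : G} (hq : ∀ z ∈ (N q).head?, z.1 ≠ t) :
    N ((f s * f t) ^ j * q) = (List.replicate j [(s, 1), (t, 1)]).flatten ++ N q := by
  induction j with
  | zero => simp
  | succ j ih =>
    have hhead : ∀ z ∈ (N ((f s * f t) ^ j * q)).head?, z.1 ≠ t := by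
      rw [ih]
      rcases j with _ | j
      · simpa using hq
      · simp [List.replicate_succ, hst]
    have := hN.pow_mul_pow_mul hst one_pos (by omega) one_pos (by omega) hhead
    rw [pow_one, pow_one, ih] at this
    rw [pow_succ', mul_assoc, this]
    simp [List.replicate_succ]

lemma chain_injOn (hN : IsNormalForm f ord N) (hst : s ≠ t) (hs : 2 ≤ ord s) (ht : 2 ≤ ord t) :
    Set.InjOn (fun c : ℕ × ℕ => (f s * f t) ^ c.1 * f s ^ c.2) {c | c.2 < ord s} := by
  have hlen (j x : ℕ) (hx : x < ord s) :
      (N ((f s * f t) ^ j * f s ^ x)).length = 2 * j + if x = 0 then 0 else 1 := by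
    split_ifs with h
    · subst h
      rw [hN.chain_mul hst hs ht j (by simp [hN.one])]
      simp [hN.one, mul_comm]
    · have hx' := hN.pow (Nat.pos_of_ne_zero h) hx
      rw [hN.chain_mul hst hs ht j (by simp [hx', hst])]
      simp [hx', mul_comm]
  rintro ⟨j, x⟩ hx ⟨j', x'⟩ hx' h
  dsimp only at h
  have h' := congrArg (fun g => (N g).length) h
  simp only [hlen j x hx, hlen j' x' hx'] at h'
  obtain rfl : j = j' := by split_ifs at h' <;> omega
  rw [mul_right_inj] at h
  exact congrArg (Prod.mk j) (hN.pow_injOn s hx hx' h)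

lemma cheeger_le (hN : IsNormalForm f ord N) (hst : s ≠ t) (hcover : ∀ i, i = s ∨ i = t)
    (hs : 2 ≤ ord s) (ht : 2 ≤ ord t) : cheeger f ≤ 2 - 2 / ord s := by
  classical
  let : Fintype ι := ⟨{s, t}, by simpa using hcover⟩
  have hm : (2 : ℝ) ≤ ord s := by exact_mod_cast hs
  let v : ℕ × ℕ → G := fun c => (f s * f t) ^ c.1 * f s ^ c.2
  have key (l : ℕ) : cheeger f ≤ 2 * ((l + 1) * ord s - l) / ((l + 1) * ord s) := by
    let I := Finset.range (l + 1) ×ˢ Finset.range (ord s)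
    let J : Finset (ℕ × ℕ) := Finset.range l ×ˢ {1}
    have hJI : J ⊆ I := by
      rintro ⟨j, x⟩ h
      simp only [J, I, Finset.mem_product, Finset.mem_range, Finset.mem_singleton] at h ⊢
      omega
    have hKcard : (I.image v).card = (l + 1) * ord s := by
      rw [Finset.card_image_of_injOn]
      · simp [I]
      · refine (hN.chain_injOn hst hs ht).mono ?_
        rintro ⟨j, x⟩ h
        simp only [I, Finset.coe_product, Finset.coe_range, Set.mem_prod, Set.mem_Iio] at h
        exact h.2
    have hne : (I.image v).Nonempty := by
      rw [← Finset.card_pos, hKcard]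
      positivity
    have hB := cheeger_le_of_leaving_subset f hne ((I \ J).image fun c => (v c, t)) ?_
    · refine hB.trans ?_
      rw [hKcard]
      push_cast
      gcongr
      have h1 : (((I \ J).image fun c => (v c, t)).card : ℝ) ≤ (I \ J).card :=
        Nat.cast_le.2 Finset.card_image_le
      have h2 : (J.card : ℝ) = l := by simp [J]
      have h3 : (I.card : ℝ) = (l + 1) * ord s := by simp [I]
      rwa [Finset.cast_card_sdiff hJI, h2, h3] at h1
    · intro a ha i hi
      obtain ⟨⟨j, x⟩, hc, rfl⟩ := Finset.mem_image.1 ha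
      have hjx : j < l + 1 ∧ x < ord s := by simpa [I] using hc
      rcases hcover i with rfl | rfl
      · refine absurd (Finset.mem_image.2 ?_) hi
        rcases Nat.lt_or_ge (x + 1) (ord i) with hx | hx
        · exact ⟨(j, x + 1), by simp [I, hx, hjx.1], by simp [v, pow_succ, mul_assoc]⟩
        · refine ⟨(j, 0), by simp [I, hjx.1]; omega, ?_⟩
          have : x + 1 = ord i := by omega
          simp only [v, mul_assoc]
          rw [← pow_succ, this, hN.pow_ord, pow_zero]
      · refine Finset.mem_image.2 ⟨(j, x), Finset.mem_sdiff.2 ⟨hc, fun hJ => hi ?_⟩, rfl⟩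
        have hJ' : j < l ∧ 1 = x := by simpa [J] using hJ
        obtain ⟨hj, rfl⟩ := hJ'
        refine Finset.mem_image.2 ⟨(j + 1, 0), by simp [I, hj]; omega, ?_⟩
        simp [v, pow_succ, mul_assoc]
  have key' (l : ℕ) : (ord s * cheeger f - 2 * ord s + 2) * (l + 1) ≤ 2 := by
    have := key l
    rw [le_div_iff₀ (by positivity)] at this
    nlinarith
  have hle : ord s * cheeger f - 2 * ord s + 2 ≤ 0 := by
    by_contra! hpos
    obtain ⟨l, hl⟩ := exists_nat_gt (2 / (ord s * cheeger f - 2 * ord s + 2))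
    rw [div_lt_iff₀ hpos] at hl
    have := key' l
    nlinarith
  have hdiv : (2 : ℝ) / ord s * ord s = 2 := div_mul_cancel₀ _ (by positivity)
  nlinarith

/-- For the orders two and three, a chain of three triangles with all their pendant double edges
gives a better bound than chains of double edges. -/
lemma cheeger_le_five_sixths (hN : IsNormalForm f ord N) (hst : s ≠ t)
    (hcover : ∀ i, i = s ∨ i = t) (hs : ord s = 2) (ht : ord t = 3) : cheeger f ≤ 5 / 6 := by
  classical
  let : Fintype ι := ⟨{s, t}, by simpa using hcover⟩
  have hs2 : f s * f s = 1 := by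
    have := hN.pow_ord s
    rwa [hs, pow_two] at this
  have ht3 : f t * (f t * f t) = 1 := by
    have := hN.pow_ord t
    rwa [ht, pow_succ', pow_two] at this
  let R : Finset (ℕ × ℕ) := {(0, 0), (1, 0), (2, 0), (2, 1)}
  let v : ℕ × ℕ × ℕ → G := fun c => (f t * f s) ^ c.1 * (f t ^ c.2.1 * f s ^ c.2.2)
  let I : Finset (ℕ × ℕ × ℕ) := Finset.range 3 ×ˢ R
  have hNr (x y : ℕ) (h : (x, y) ∈ R) : N (f t ^ x * f s ^ y) =
      if x = 0 then [] else if y = 0 then [(t, x)] else [(t, x), (s, y)] := by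
    simp only [R, Finset.mem_insert, Finset.mem_singleton, Prod.mk.injEq] at h
    have h1 : N (f t) = [(t, 1)] := by simpa using hN.pow (i := t) (k := 1) one_pos (by omega)
    rcases h with ⟨rfl, rfl⟩ | ⟨rfl, rfl⟩ | ⟨rfl, rfl⟩ | ⟨rfl, rfl⟩
    · simp [hN.one]
    · simp [h1]
    · simp [hN.pow (i := t) (k := 2) two_pos (by omega)]
    · have := hN.pow_mul_pow_mul hst.symm (x := 2) (y := 1) two_pos (by omega) one_pos (by omega)
        (q := 1) (by simp [hN.one])
      simpa [hN.one] using this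
  have hNv (j x y : ℕ) (h : (x, y) ∈ R) : N (v (j, x, y)) =
      (List.replicate j [(t, 1), (s, 1)]).flatten ++ N (f t ^ x * f s ^ y) := by
    refine hN.chain_mul hst.symm (by omega) (by omega) j ?_
    rw [hNr x y h]
    split_ifs <;> simp [hst.symm]
  have hinj : Set.InjOn v I := by
    have hcount (j : ℕ) :
        (List.replicate j [(t, 1), (s, 1)]).flatten.count ((t, 2) : ι × ℕ) = 0 := by
      simp [List.count_eq_zero]
    rintro ⟨j, x, y⟩ h ⟨j', x', y'⟩ h' heq
    have hR : (x, y) ∈ R := (Finset.mem_product.1 h).2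
    have hR' : (x', y') ∈ R := (Finset.mem_product.1 h').2
    have e1 := congrArg (fun g => (N g).length) heq
    have e2 := congrArg (fun g => (N g).count (t, 2)) heq
    simp only [hNv j x y hR, hNv j' x' y' hR', hNr x y hR, hNr x' y' hR', List.length_append,
      List.count_append, hcount] at e1 e2
    simp only [R, Finset.mem_insert, Finset.mem_singleton, Prod.mk.injEq] at hR hR'
    rcases hR with ⟨rfl, rfl⟩ | ⟨rfl, rfl⟩ | ⟨rfl, rfl⟩ | ⟨rfl, rfl⟩ <;>
      rcases hR' with ⟨rfl, rfl⟩ | ⟨rfl, rfl⟩ | ⟨rfl, rfl⟩ | ⟨rfl, rfl⟩ <;>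
      simp at e1 e2 ⊢ <;> omega
  have hcard : (I.image v).card = 12 := by
    rw [Finset.card_image_of_injOn hinj]
    rfl
  have hne : (I.image v).Nonempty := by
    rw [← Finset.card_pos, hcard]
    norm_num
  let B : Finset (G × ι) :=
    {(v (0, 0, 0), s), (v (2, 1, 0), s), (v (0, 2, 1), t), (v (1, 2, 1), t), (v (2, 2, 1), t)}
  have hB : (B.card : ℝ) ≤ 5 := by exact_mod_cast Finset.card_le_five
  refine (cheeger_le_of_leaving_subset f hne B ?_).trans ?_
  · have hmem (c : ℕ × ℕ × ℕ) (hc : c ∈ I) {g : G} (hg : g = v c) : g ∈ I.image v :=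
      Finset.mem_image.2 ⟨c, hc, hg.symm⟩
    intro a ha i hi
    obtain ⟨⟨j, x, y⟩, hc, rfl⟩ := Finset.mem_image.1 ha
    obtain ⟨hj, hR⟩ := Finset.mem_product.1 hc
    have hj3 : j < 3 := Finset.mem_range.1 hj
    simp only [R, Finset.mem_insert, Finset.mem_singleton, Prod.mk.injEq] at hR
    rcases hR with ⟨rfl, rfl⟩ | ⟨rfl, rfl⟩ | ⟨rfl, rfl⟩ | ⟨rfl, rfl⟩ <;>
      rcases hcover i with rfl | rfl
    · rcases j with _ | j
      · simp [B]
      · refine absurd (hmem (j, 1, 0) (by simp [I, R]; omega) ?_) hi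
        simp [v, pow_succ, mul_assoc, hs2]
    · exact absurd (hmem (j, 1, 0) (by simp [I, R]; omega) (by simp [v])) hi
    · rcases Nat.lt_or_ge (j + 1) 3 with hj' | hj'
      · refine absurd (hmem (j + 1, 0, 0) (by simp [I, R]; omega) ?_) hi
        simp [v, pow_succ, mul_assoc]
      · obtain rfl : j = 2 := by omega
        simp [B]
    · exact absurd (hmem (j, 2, 0) (by simp [I, R]; omega)
        (by simp [v, pow_two, mul_assoc])) hi
    · exact absurd (hmem (j, 2, 1) (by simp [I, R]; omega) (by simp [v, mul_assoc])) hi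
    · exact absurd (hmem (j, 0, 0) (by simp [I, R]; omega)
        (by simp [v, pow_two, mul_assoc, ht3])) hi
    · exact absurd (hmem (j, 2, 0) (by simp [I, R]; omega)
        (by simp [v, mul_assoc, hs2])) hi
    · interval_cases j <;> simp [B]
  · rw [hcard]
    push_cast
    rw [div_le_div_iff₀ (by norm_num) (by norm_num)]
    linarith

lemma pc_lt (hN : IsNormalForm f ord N) (hst : s ≠ t) {a b : ℕ} (hs : ord s = a + 1)
    (ht : ord t = b + 1) {μ : ℝ → Measure (Config (G × ι))}
    (hμ : ∀ p ∈ Set.Icc (0 : ℝ) 1, IsBernoulli p (μ p)) {p : ℝ} (hp0 : 0 < p) (hp1 : p ≤ 1)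
    (hmean : 1 < arcMean a p * arcMean b p) : pc f μ < p := by
  have hcont : Continuous fun p => arcMean a p * arcMean b p :=
    (continuous_arcMean a).mul (continuous_arcMean b)
  obtain ⟨r, hr, hr0, hrp⟩ := (((hcont.tendsto p).mono_left nhdsWithin_le_nhds).eventually_const_lt
    hmean |>.and (Ioo_mem_nhdsLT hp0)).exists
  have hrI : r ∈ Set.Icc (0 : ℝ) 1 := ⟨hr0.le, hrp.le.trans hp1⟩
  refine lt_of_le_of_lt (csInf_le ⟨0, ?_⟩
    (Or.inl ⟨hrI, hN.theta_pos hst hs ht hr0.le (hμ r hrI) hr⟩)) hrp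
  rintro x (hx | rfl)
  · exact hx.1.1
  · exact zero_le_one

theorem pc_lt_one_div_cheeger_add_one (hN : IsNormalForm f ord N) (hst : s ≠ t)
    (hcover : ∀ i, i = s ∨ i = t) (hs : 2 ≤ ord s) (hle : ord s ≤ ord t) (ht : 3 ≤ ord t)
    {μ : ℝ → Measure (Config (G × ι))} (hμ : ∀ p ∈ Set.Icc (0 : ℝ) 1, IsBernoulli p (μ p)) :
    pc f μ < 1 / (cheeger f + 1) := by
  obtain ⟨a, ha⟩ := Nat.exists_eq_add_of_le' (show 1 ≤ ord s by omega)
  obtain ⟨b, hb⟩ := Nat.exists_eq_add_of_le' (show 1 ≤ ord t by omega)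
  have hc0 := cheeger_nonneg f
  have hc := hN.cheeger_le hst hcover hs (by omega)
  suffices ∃ p : ℝ, 0 < p ∧ p * (cheeger f + 1) ≤ 1 ∧ 1 < arcMean a p * arcMean b p by
    obtain ⟨p, hp0, hp, hmean⟩ := this
    refine (hN.pc_lt hst ha hb hμ hp0 (by nlinarith) hmean).trans_le ?_
    rwa [le_div_iff₀ (by positivity)]
  rcases (show a = 1 ∧ b = 2 ∨ a = 1 ∧ 3 ≤ b ∨ 2 ≤ a by omega) with ⟨rfl, rfl⟩ | ⟨rfl, h3⟩ | h2
  · refine ⟨6 / 11, by norm_num, ?_, ?_⟩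
    · have := hN.cheeger_le_five_sixths hst hcover ha hb
      linarith
    · norm_num [arcMean, Finset.sum_range_succ]
  · refine ⟨1 / 2, by norm_num, ?_, ?_⟩
    · rw [ha] at hc
      norm_num at hc
      linarith
    · have h1 : arcMean 1 (1 / 2 : ℝ) = 3 / 4 := by norm_num [arcMean]
      have h2 : (25 / 16 : ℝ) ≤ arcMean b (1 / 2) := by
        refine le_trans ?_ (arcMean_mono (by norm_num) (by norm_num) h3)
        norm_num [arcMean, Finset.sum_range_succ]
      rw [h1]
      linarith
  · have ha0 : (2 : ℝ) ≤ a := by exact_mod_cast h2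
    have hp1 : ((a : ℝ) + 1) / (3 * a + 1) ≤ 1 := by
      rw [div_le_one (by positivity)]
      linarith
    refine ⟨(a + 1) / (3 * a + 1), by positivity, ?_, ?_⟩
    · rw [ha] at hc
      push_cast at hc
      have : cheeger f + 1 ≤ (3 * a + 1) / (a + 1) := by
        refine (add_le_add_left hc 1).trans (le_of_eq ?_)
        field_simp
        ring
      refine (mul_le_mul_of_nonneg_left this (by positivity)).trans (le_of_eq ?_)
      field_simp
    · have h1 := one_lt_arcMean h2
      have h4 := arcMean_mono (by positivity) hp1 (show a ≤ b by omega)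
      exact one_lt_mul_of_lt_of_le h1 (h1.le.trans h4)

end IsNormalForm

section CyclicWords

variable {G ι : Type*} [Group G]

/-- The cyclic group of order `ord i`, as a multiplicative group. -/
abbrev CyclicFactor (ord : ι → ℕ) (i : ι) : Type := Multiplicative (ZMod (ord i))

/-- The list of syllables, with exponents, of an element of a free product of cyclic groups. -/
noncomputable def syllables [DecidableEq ι] (ord : ι → ℕ)
    (g : Monoid.CoprodI (CyclicFactor ord)) : List (ι × ℕ) :=
  (Monoid.CoprodI.Word.equiv g).toList.map fun x => (x.1, x.2.toAdd.val)

lemma isNormalForm_syllables [DecidableEq ι] {f : ι → G} {ord : ι → ℕ}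
    (φ : G →* Monoid.CoprodI (CyclicFactor ord))
    (hφ : ∀ i, φ (f i) = Monoid.CoprodI.of (M := CyclicFactor ord) (i := i)
      (Multiplicative.ofAdd (1 : ZMod (ord i))))
    (hf : ∀ i, f i ^ ord i = 1) : IsNormalForm f ord fun g => syllables ord (φ g) where
  pow_ord := hf
  one := by
    have : Monoid.CoprodI.Word.equiv (1 : Monoid.CoprodI (CyclicFactor ord)) =
        Monoid.CoprodI.Word.empty := by
      rw [← Monoid.CoprodI.Word.prod_empty]
      exact Monoid.CoprodI.Word.equiv.apply_symm_apply
        (Monoid.CoprodI.Word.empty (M := CyclicFactor ord))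
    simp [syllables, this, Monoid.CoprodI.Word.empty]
  pow_mul i k q hk hki hq := by
    let w := Monoid.CoprodI.Word.equiv (φ q)
    have hw : w.prod = φ q := Monoid.CoprodI.Word.equiv.symm_apply_apply _
    have hval : (k : ZMod (ord i)).val = k := ZMod.val_natCast_of_lt hki
    have hne : Multiplicative.ofAdd (k : ZMod (ord i)) ≠ 1 := by
      intro h
      rw [ofAdd_eq_one] at h
      rw [h, ZMod.val_zero] at hval
      omega
    have hidx : w.fstIdx ≠ some i := by
      rw [Monoid.CoprodI.Word.fstIdx_ne_iff]
      intro l hl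
      refine (hq (l.1, l.2.toAdd.val) ?_).symm
      simp only [syllables, List.head?_map]
      exact Option.mem_map_of_mem _ hl
    have heq : Monoid.CoprodI.Word.equiv (φ (f i ^ k * q)) =
        Monoid.CoprodI.Word.cons (M := CyclicFactor ord) (i := i)
          (Multiplicative.ofAdd (k : ZMod (ord i))) w hidx hne := by
      rw [← Equiv.eq_symm_apply]
      refine Eq.trans ?_ (Monoid.CoprodI.Word.prod_cons i _ w hne hidx).symm
      rw [map_mul, map_pow, hφ, hw, ← map_pow, ← ofAdd_nsmul, nsmul_one]
    simp only [syllables, heq]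
    simp [Monoid.CoprodI.Word.cons, hval, w]

end CyclicWords

section CyclicFreeProduct

variable (m n : ℕ)

/-- The generators of a free product of two cyclic groups. -/
abbrev CyclicGens : Type :=
  ({Multiplicative.ofAdd (1 : ZMod m)} : Set (Multiplicative (ZMod m))) ⊕
    ({Multiplicative.ofAdd (1 : ZMod n)} : Set (Multiplicative (ZMod n)))

/-- The orders of the generators of a free product of two cyclic groups. -/
def cyclicOrd : CyclicGens m n → ℕ := Sum.elim (fun _ => m) fun _ => n

lemma coprodGens_pow_cyclicOrd (i : CyclicGens m n) :
    coprodGens {Multiplicative.ofAdd (1 : ZMod m)} {Multiplicative.ofAdd (1 : ZMod n)} i ^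
      cyclicOrd m n i = 1 := by
  have h (k : ℕ) : Multiplicative.ofAdd (1 : ZMod k) ^ k = 1 := by
    rw [← ofAdd_nsmul]
    simp
  rcases i with ⟨_, rfl⟩ | ⟨_, rfl⟩
  · simp only [coprodGens, cyclicOrd, Sum.elim_inl, ← map_pow, h, map_one]
  · simp only [coprodGens, cyclicOrd, Sum.elim_inr, ← map_pow, h, map_one]

lemma exists_isNormalForm_coprodGens : ∃ N, IsNormalForm
    (coprodGens {Multiplicative.ofAdd (1 : ZMod m)} {Multiplicative.ofAdd (1 : ZMod n)})
    (cyclicOrd m n) N := by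
  classical
  let φ : Monoid.Coprod (Multiplicative (ZMod m)) (Multiplicative (ZMod n)) →*
      Monoid.CoprodI (CyclicFactor (cyclicOrd m n)) :=
    Monoid.Coprod.lift
      (Monoid.CoprodI.of (M := CyclicFactor (cyclicOrd m n))
        (i := Sum.inl ⟨_, rfl⟩))
      (Monoid.CoprodI.of (M := CyclicFactor (cyclicOrd m n))
        (i := Sum.inr ⟨_, rfl⟩))
  refine ⟨_, isNormalForm_syllables φ ?_ (coprodGens_pow_cyclicOrd m n)⟩
  rintro (⟨_, rfl⟩ | ⟨_, rfl⟩)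
  · exact Monoid.Coprod.lift_apply_inl _ _ _
  · exact Monoid.Coprod.lift_apply_inr _ _ _

end CyclicFreeProduct

end Perc

open Perc

/-- For the Cayley graph `𝒢` of `C_m * C_n` (with `m, n ≥ 2` and
`(m-1)(n-1) > 1`) with respect to the standard generators (one generator per cyclic
factor), the critical probability satisfies `1/3 < p_c < 1/(h(𝒢) + 1)`, where `h(𝒢)` is
the Cheeger constant. -/
theorem pc_cyclic_free_product_strict_bounds
    (m n : ℕ) (hm : 2 ≤ m) (hn : 2 ≤ n) (h : 1 < (m - 1) * (n - 1))
    (μ : ℝ → Measure (Config (Monoid.Coprod (Multiplicative (ZMod m)) (Multiplicative (ZMod n)) ×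
      (({Multiplicative.ofAdd (1 : ZMod m)} : Set (Multiplicative (ZMod m))) ⊕
       ({Multiplicative.ofAdd (1 : ZMod n)} : Set (Multiplicative (ZMod n)))))))
    (hμ : ∀ p ∈ Set.Icc (0 : ℝ) 1, IsBernoulli p (μ p)) :
    1 / 3 < pc (coprodGens ({Multiplicative.ofAdd (1 : ZMod m)} : Set (Multiplicative (ZMod m)))
        ({Multiplicative.ofAdd (1 : ZMod n)} : Set (Multiplicative (ZMod n)))) μ ∧
    pc (coprodGens ({Multiplicative.ofAdd (1 : ZMod m)} : Set (Multiplicative (ZMod m)))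
        ({Multiplicative.ofAdd (1 : ZMod n)} : Set (Multiplicative (ZMod n)))) μ
      < 1 / (cheeger (coprodGens ({Multiplicative.ofAdd (1 : ZMod m)} : Set (Multiplicative (ZMod m)))
          ({Multiplicative.ofAdd (1 : ZMod n)} : Set (Multiplicative (ZMod n)))) + 1) := by
  have hpow (i : CyclicGens m n) :
      coprodGens {Multiplicative.ofAdd (1 : ZMod m)} {Multiplicative.ofAdd (1 : ZMod n)} i ^
        (m * n) = 1 := by
    obtain ⟨k, hk⟩ : cyclicOrd m n i ∣ m * n := by
      rcases i with i | i
      · exact dvd_mul_right m n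
      · exact dvd_mul_left n m
    rw [hk, pow_mul, coprodGens_pow_cyclicOrd, one_pow]
  refine ⟨?_, ?_⟩
  · exact_mod_cast one_div_lt_pc_of_pow_eq_one (b := 3) (by simp) (by norm_num) (by positivity)
      hpow hμ
  · obtain ⟨N, hN⟩ := exists_isNormalForm_coprodGens m n
    have hcover (i : CyclicGens m n) : i = Sum.inl ⟨_, rfl⟩ ∨ i = Sum.inr ⟨_, rfl⟩ := by
      rcases i with ⟨_, rfl⟩ | ⟨_, rfl⟩ <;> simp
    have h3 : 3 ≤ m ∨ 3 ≤ n := by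
      by_contra! hlt
      obtain rfl : m = 2 := by omega
      obtain rfl : n = 2 := by omega
      norm_num at h
    rcases le_total m n with hmn | hmn
    · exact hN.pc_lt_one_div_cheeger_add_one (s := Sum.inl ⟨_, rfl⟩) (t := Sum.inr ⟨_, rfl⟩)
        (by simp) hcover hm hmn (show 3 ≤ n by omega) hμ
    · exact hN.pc_lt_one_div_cheeger_add_one (s := Sum.inr ⟨_, rfl⟩) (t := Sum.inl ⟨_, rfl⟩)
        (by simp) (fun i => (hcover i).symm) hn hmn (show 3 ≤ m by omega) hμ
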